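/- arXiv:math/0410311 — 2 statements merged into one kernel-verified Lean document; each statement's English description precedes it below -/
import Mathlib

section
/- Consider a branching process whose family-size probability generating function G satisfies G(0)=0 and 1<G'(1)<∞, and let p∈[0,1). The following are equivalent: (i) γ=1, i.e., almost surely every infinite directed path from the root contains a blue vertex; (ii) G'(1−pθ)≤1; (iii) p_G ≤ p ≤ 1, where p_G is the unique value of p∈[0,1] satisfying G'(1−p_G·θ(p_G))=1 (in particular such a value exists and is unique). -/
open MeasureTheory
open scoped ENNReal

namespace GW

/-- A point of the sample space: for each finite word `w` (a potential vertex of the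
family-tree), the pair consisting of the number of children of `w` and the state
(open = `true`) of the edge leading into `w`. -/
abbrev Cfg := List ℕ → ℕ × Bool

/-- The word formed by the first `n` values of the sequence `s`. -/
def prefixSeq (s : ℕ → ℕ) (n : ℕ) : List ℕ := List.ofFn fun i : Fin n => s i

/-- The word `w` is a vertex of the family-tree determined by `ω`: each letter of `w` is
smaller than the offspring number of the corresponding prefix. -/
def InTree (ω : Cfg) (w : List ℕ) : Prop :=
  ∀ i : Fin w.length, w.get i < (ω (w.take i)).1

/-- The vertex `v` is blue: some infinite directed path of the tree starting at `v`
consists entirely of open edges. -/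
def BlueAt (ω : Cfg) (v : List ℕ) : Prop :=
  ∃ s : ℕ → ℕ, ∀ n : ℕ,
    InTree ω (v ++ prefixSeq s (n + 1)) ∧ (ω (v ++ prefixSeq s (n + 1))).2 = true

/-- The root is black: every infinite directed path of the tree starting at the root
contains a blue vertex. -/
def BlackRoot (ω : Cfg) : Prop :=
  ∀ s : ℕ → ℕ, (∀ n, InTree ω (prefixSeq s n)) → ∃ n, BlueAt ω (prefixSeq s n)

/-- `P` is the law of a Galton–Watson tree with offspring distribution `a` together with
independent bond percolation with density `p`: the coordinates are i.i.d., with offspring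
numbers distributed according to `a` independent of edge states which are Bernoulli(`p`). -/
def IsGWPerc (a : ℕ → ℝ) (p : ℝ) (P : Measure Cfg) : Prop :=
  IsProbabilityMeasure P ∧
    ∀ (s : Finset (List ℕ)) (g : List ℕ → ℕ × Bool),
      P {ω | ∀ w ∈ s, ω w = g w} =
        ∏ w ∈ s,
          (ENNReal.ofReal (a (g w).1) * ENNReal.ofReal (if (g w).2 then p else 1 - p))


/-- The configuration seen from the vertex `v`. -/
def shift (v : List ℕ) (ω : Cfg) : Cfg := fun w => ω (v ++ w)

@[simp] lemma shift_nil (ω : Cfg) : shift [] ω = ω := rfl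

lemma shift_shift (u v : List ℕ) (ω : Cfg) : shift v (shift u ω) = shift (u ++ v) ω := by
  funext w
  simp [shift, List.append_assoc]

@[simp] lemma prefixSeq_zero (s : ℕ → ℕ) : prefixSeq s 0 = [] := rfl

lemma prefixSeq_succ (s : ℕ → ℕ) (n : ℕ) : prefixSeq s (n + 1) = prefixSeq s n ++ [s n] := by
  rw [prefixSeq, List.ofFn_succ_last]
  rfl

lemma prefixSeq_succ_left (s : ℕ → ℕ) (n : ℕ) :
    prefixSeq s (n + 1) = s 0 :: prefixSeq (fun m => s (m + 1)) n := by
  simp [prefixSeq, List.ofFn_succ]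

lemma inTree_append_singleton (ω : Cfg) (w : List ℕ) (i : ℕ) :
    InTree ω (w ++ [i]) ↔ InTree ω w ∧ i < (ω w).1 := by
  simp only [InTree, Fin.forall_iff, List.get_eq_getElem]
  constructor
  · intro h
    refine ⟨fun j hj => ?_, ?_⟩
    · have := h j (by simp; omega)
      rwa [List.getElem_append_left hj, List.take_append_of_le_length hj.le] at this
    · simpa using h w.length (by simp)
  · rintro ⟨h, hi⟩ j hj
    rcases (show j < w.length ∨ j = w.length by simp at hj; omega) with hj' | rfl
    · rw [List.getElem_append_left hj', List.take_append_of_le_length hj'.le]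
      exact h j hj'
    · simpa using hi

lemma inTree_append_prefixSeq (ω : Cfg) (v : List ℕ) (s : ℕ → ℕ) (n : ℕ) :
    InTree ω (v ++ prefixSeq s n) ↔
      InTree ω v ∧ ∀ m < n, s m < (ω (v ++ prefixSeq s m)).1 := by
  induction n with
  | zero => simp
  | succ n ih =>
    rw [prefixSeq_succ, ← List.append_assoc, inTree_append_singleton, ih]
    simp only [Nat.lt_succ_iff_lt_or_eq, or_imp, forall_and, forall_eq, and_assoc]

/-- There is an infinite path from the root all of whose non-root vertices see a configuration
satisfying `A`. -/
def Ray (A : Cfg → Prop) (ω : Cfg) : Prop :=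
  ∃ s : ℕ → ℕ, ∀ n, s n < (ω (prefixSeq s n)).1 ∧ A (shift (prefixSeq s (n + 1)) ω)

/-- There is a path of length `n` from the root all of whose non-root vertices see a
configuration satisfying `A`. -/
def Level (A : Cfg → Prop) : ℕ → Cfg → Prop
  | 0, _ => True
  | n + 1, ω => ∃ i < (ω []).1, A (shift [i] ω) ∧ Level A n (shift [i] ω)

lemma Level.of_succ {A : Cfg → Prop} {n : ℕ} {ω : Cfg} (h : Level A (n + 1) ω) :
    Level A n ω := by
  induction n generalizing ω with
  | zero => trivial
  | succ n ih =>
    obtain ⟨i, hi, hA, hL⟩ := h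
    exact ⟨i, hi, hA, ih hL⟩

lemma Level.of_le {A : Cfg → Prop} {m n : ℕ} (hmn : m ≤ n) {ω : Cfg} (h : Level A n ω) :
    Level A m ω := by
  induction n, hmn using Nat.le_induction with
  | base => exact h
  | succ n _ ih => exact ih h.of_succ

lemma exists_child_of_forall_level {A : Cfg → Prop} {ω : Cfg} (h : ∀ n, Level A n ω) :
    ∃ i < (ω []).1, A (shift [i] ω) ∧ ∀ n, Level A n (shift [i] ω) := by
  choose f hf hA hL using fun n => h (n + 1)
  obtain ⟨i, hi⟩ := Finite.exists_infinite_fiber fun n => (⟨f n, hf n⟩ : Fin (ω []).1)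
  have hinf := Set.infinite_coe_iff.1 hi
  have key : ∀ n, ∃ m, n ≤ m ∧ f m = i := fun n => by
    obtain ⟨m, hm, hnm⟩ := hinf.exists_gt n
    exact ⟨m, hnm.le, congrArg Fin.val hm⟩
  refine ⟨i, i.2, ?_, fun n => ?_⟩
  · obtain ⟨m, -, hm⟩ := key 0
    exact hm ▸ hA m
  · obtain ⟨m, hnm, hm⟩ := key n
    exact hm ▸ (hL m).of_le hnm

/-- König's lemma. -/
lemma ray_iff_forall_level {A : Cfg → Prop} {ω : Cfg} : Ray A ω ↔ ∀ n, Level A n ω := by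
  constructor
  · rintro ⟨s, hs⟩ n
    induction n generalizing ω s with
    | zero => trivial
    | succ n ih =>
      refine ⟨s 0, (hs 0).1, by simpa [prefixSeq_succ] using (hs 0).2,
        ih (fun m => s (m + 1)) fun m => ?_⟩
      have h := hs (m + 1)
      rw [prefixSeq_succ_left, prefixSeq_succ_left s (m + 1)] at h
      exact ⟨h.1, by simpa [shift_shift] using h.2⟩
  · intro h
    choose f hf hA hL using
      fun x : {ω : Cfg // ∀ n, Level A n ω} => exists_child_of_forall_level x.2
    let x : ℕ → {ω : Cfg // ∀ n, Level A n ω} :=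
      fun n => n.rec ⟨ω, h⟩ fun _ y => ⟨shift [f y] y.1, hL y⟩
    have hx : ∀ n, shift (prefixSeq (fun m => f (x m)) n) ω = (x n).1 := by
      intro n
      induction n with
      | zero => rfl
      | succ n ih => rw [prefixSeq_succ, ← shift_shift, ih]
    refine ⟨fun m => f (x m), fun n => ⟨?_, ?_⟩⟩
    · have h1 := hf (x n)
      rw [← hx n] at h1
      simpa [shift] using h1
    · rw [hx]
      exact hA (x n)

lemma ray_iff_exists_child {A : Cfg → Prop} {ω : Cfg} :
    Ray A ω ↔ ∃ i < (ω []).1, A (shift [i] ω) ∧ Ray A (shift [i] ω) := by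
  simp only [ray_iff_forall_level]
  refine ⟨exists_child_of_forall_level, ?_⟩
  rintro ⟨i, hi, hA, hL⟩ n
  exact Level.of_succ ⟨i, hi, hA, hL n⟩

/-- The edge leading into the root of the configuration is open. -/
def EdgeOpen (ω : Cfg) : Prop := (ω []).2 = true

/-- The root is blue. -/
def Blue (ω : Cfg) : Prop := Ray EdgeOpen ω

lemma blueAt_iff (ω : Cfg) (v : List ℕ) : BlueAt ω v ↔ InTree ω v ∧ Blue (shift v ω) := by
  simp only [BlueAt, inTree_append_prefixSeq, Blue, Ray, EdgeOpen, shift, List.append_nil]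
  constructor
  · rintro ⟨s, hs⟩
    exact ⟨(hs 0).1.1, s, fun n => ⟨(hs n).1.2 n n.lt_succ_self, (hs n).2⟩⟩
  · rintro ⟨hv, s, hs⟩
    exact ⟨s, fun n => ⟨⟨hv, fun m _ => (hs m).1⟩, (hs n).2⟩⟩

lemma inTree_nil (ω : Cfg) : InTree ω [] := fun i => i.elim0

lemma blueAt_nil_iff (ω : Cfg) : BlueAt ω [] ↔ Blue ω := by
  simp [blueAt_iff, inTree_nil]

lemma blackRoot_iff (ω : Cfg) :
    BlackRoot ω ↔ Blue ω ∨ ¬ Ray (fun η => ¬ Blue η) ω := by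
  have htree : ∀ s : ℕ → ℕ, (∀ n, InTree ω (prefixSeq s n)) ↔
      ∀ n, s n < (ω (prefixSeq s n)).1 := by
    intro s
    have h := fun n => inTree_append_prefixSeq ω [] s n
    simp only [List.nil_append, inTree_nil, true_and] at h
    simp only [h]
    exact ⟨fun h n => h (n + 1) n n.lt_succ_self, fun h n m _ => h m⟩
  rw [or_iff_not_imp_left]
  constructor
  · rintro h hb ⟨s, hs⟩
    obtain ⟨n, hn⟩ := h s ((htree s).2 fun n => (hs n).1)
    rw [blueAt_iff] at hn
    cases n with
    | zero => exact hb (by simpa using hn.2)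
    | succ n => exact (hs n).2 hn.2
  · intro h s hs
    by_contra! hn
    simp only [blueAt_iff, not_and] at hn
    exact h (by simpa using hn 0 (hs 0))
      ⟨s, fun n => ⟨(htree s).1 hs n, hn (n + 1) (hs (n + 1))⟩⟩

@[fun_prop] lemma measurable_shift (v : List ℕ) : Measurable (shift v) :=
  measurable_pi_lambda _ fun _ => measurable_pi_apply _

lemma measurableSet_edge (t : Set (ℕ × Bool)) : MeasurableSet {ω : Cfg | ω [] ∈ t} :=
  measurable_pi_apply [] (MeasurableSet.of_discrete (s := t))

lemma measurableSet_level {A : Cfg → Prop} (hA : MeasurableSet {ω | A ω}) (n : ℕ) :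
    MeasurableSet {ω | Level A n ω} := by
  induction n with
  | zero => simp [Level]
  | succ n ih =>
    simp only [Level, Set.ofPred_exists]
    refine MeasurableSet.iUnion fun i => ?_
    refine (measurableSet_edge {x | i < x.1}).inter ?_
    exact (measurable_shift [i] hA).inter (measurable_shift [i] ih)

lemma measurableSet_ray {A : Cfg → Prop} (hA : MeasurableSet {ω | A ω}) :
    MeasurableSet {ω | Ray A ω} := by
  simp only [ray_iff_forall_level, Set.ofPred_forall]
  exact MeasurableSet.iInter (measurableSet_level hA)

lemma measurableSet_edgeOpen : MeasurableSet {ω | EdgeOpen ω} :=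
  measurableSet_edge {x | x.2 = true}

lemma measurableSet_blue : MeasurableSet {ω | Blue ω} := measurableSet_ray measurableSet_edgeOpen

/-- Index types of the blocks in the decomposition of a configuration into the data of the root
(block `none`) and the configurations seen from its children. -/
def Block : Option ℕ → Type
  | none => Unit
  | some _ => List ℕ

/-- The vertex corresponding to an element of a block. -/
def blockVertex : (Σ o, Block o) → List ℕ
  | ⟨none, _⟩ => []
  | ⟨some i, w⟩ => i :: w

lemma blockVertex_injective : Function.Injective blockVertex := by
  rintro ⟨_ | i, v⟩ ⟨_ | j, w⟩ h
  · rfl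
  · simp [blockVertex] at h
  · simp [blockVertex] at h
  · obtain ⟨rfl, rfl⟩ := List.cons.inj h
    rfl

section Percolation

variable {a : ℕ → ℝ} {p : ℝ} {P : Measure Cfg}

lemma IsGWPerc.map_root_singleton (hP : IsGWPerc a p P) (x : ℕ × Bool) :
    P.map (fun ω => ω []) {x} =
      ENNReal.ofReal (a x.1) * ENNReal.ofReal (if x.2 then p else 1 - p) := by
  rw [Measure.map_apply (measurable_pi_apply []) (measurableSet_singleton x)]
  have h := hP.2 {[]} fun _ => x
  simp only [Finset.mem_singleton, forall_eq, Finset.prod_singleton] at h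
  exact h

lemma IsGWPerc.eq_infinitePi (hP : IsGWPerc a p P) :
    P = Measure.infinitePi fun _ : List ℕ => P.map fun ω => ω [] := by
  have := hP.1
  have hprob : IsProbabilityMeasure (P.map fun ω => ω []) :=
    Measure.isProbabilityMeasure_map (measurable_pi_apply []).aemeasurable
  refine IsProjectiveLimit.unique (P := fun I : Finset (List ℕ) =>
    Measure.pi fun _ : I => P.map fun ω => ω []) (fun I => ?_)
    (Measure.isProjectiveLimit_infinitePi _)
  refine Measure.ext_of_singleton fun f => ?_
  rw [Measure.map_apply (Finset.measurable_restrict I) (measurableSet_singleton f),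
    Measure.pi_singleton]
  classical
  have h := hP.2 I fun w => if hw : w ∈ I then f ⟨w, hw⟩ else (0, false)
  have hset : I.restrict (π := fun _ => ℕ × Bool) ⁻¹' {f} =
      {ω : Cfg | ∀ w ∈ I, ω w = if hw : w ∈ I then f ⟨w, hw⟩ else (0, false)} := by
    ext ω
    simp only [Set.mem_preimage, Set.mem_singleton_iff, funext_iff, Finset.restrict,
      Subtype.forall, Set.mem_ofPred_eq]
    exact forall₂_congr fun w hw => by simp [hw]
  rw [hset, h, ← Finset.prod_coe_sort]
  refine Finset.prod_congr rfl fun w _ => ?_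
  simp [hP.map_root_singleton]

lemma IsGWPerc.measure_branch (hP : IsGWPerc a p P) (x : ℕ × Bool) (k : ℕ) {E : Set Cfg}
    (hE : MeasurableSet E) :
    P {ω | ω [] = x ∧ ∀ i < k, shift [i] ω ∈ E} =
      ENNReal.ofReal (a x.1) * ENNReal.ofReal (if x.2 then p else 1 - p) * P E ^ k := by
  have := hP.1
  set μ : Measure (ℕ × Bool) := P.map fun ω => ω []
  have hprob : IsProbabilityMeasure μ :=
    Measure.isProbabilityMeasure_map (measurable_pi_apply []).aemeasurable
  have hx : μ {x} = ENNReal.ofReal (a x.1) * ENNReal.ofReal (if x.2 then p else 1 - p) :=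
    hP.map_root_singleton x
  have hPμ : P = Measure.infinitePi fun _ : List ℕ => μ := hP.eq_infinitePi
  let Φ : Cfg → ∀ o : Option ℕ, Block o → ℕ × Bool := fun ω o b => ω (blockVertex ⟨o, b⟩)
  have hΦm : Measurable Φ := by
    refine measurable_pi_lambda _ fun o => measurable_pi_lambda _ fun b => ?_
    exact measurable_pi_apply _
  have hΦ : P.map Φ = Measure.infinitePi fun o : Option ℕ =>
      Measure.infinitePi fun _ : Block o => μ := by
    rw [← Measure.infinitePi_map_piCurry (fun (o : Option ℕ) (_ : Block o) => μ),
      ← Measure.map_infinitePi_infinitePi_of_inj (P := fun _ : List ℕ => μ)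
        blockVertex_injective, ← hPμ, Measure.map_map (by fun_prop) (by fun_prop)]
    rfl
  let t : ∀ o : Option ℕ, Set (Block o → ℕ × Bool)
    | none => {f | f () = x}
    | some _ => E
  have ht : ∀ o, MeasurableSet (t o) := by
    rintro (_ | i)
    · exact (measurable_pi_apply (X := fun _ : Unit => ℕ × Bool) ())
        (measurableSet_singleton x)
    · exact hE
  have hset : {ω | ω [] = x ∧ ∀ i < k, shift [i] ω ∈ E} =
      Φ ⁻¹' Set.pi (Finset.insertNone (Finset.range k)) t := by
    ext ω
    simp only [Set.mem_ofPred_eq, Set.mem_preimage, Set.mem_pi, Finset.mem_coe,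
      Option.forall, Finset.none_mem_insertNone, Finset.some_mem_insertNone, Finset.mem_range,
      true_imp_iff]
    rfl
  rw [hset, ← Measure.map_apply hΦm (.pi (Finset.countable_toSet _) fun _ _ => ht _), hΦ,
    Measure.infinitePi_pi _ fun _ _ => ht _, Finset.prod_insertNone]
  have hnone : Measure.infinitePi (fun _ : Block none => μ) (t none) = μ {x} := by
    exact (measurePreserving_eval_infinitePi (fun _ : Unit => μ) ()).measure_preimage
      (measurableSet_singleton x).nullMeasurableSet
  have hsome : ∀ i, Measure.infinitePi (fun _ : Block (some i) => μ) (t (some i)) = P E := by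
    intro i
    conv_rhs => rw [hPμ]
    rfl
  rw [hnone, hx]
  simp [hsome]

/-- The recursion along the first generation: the state of the edge into the root is
independent of what happens above the root, and the subtrees of the children are i.i.d. -/
lemma IsGWPerc.real_branch (hP : IsGWPerc a p P) (ha : ∀ k, 0 ≤ a k)
    (hp : p ∈ Set.Icc (0 : ℝ) 1) (b : Bool) {E : Set Cfg} (hE : MeasurableSet E) :
    P.real {ω | (ω []).2 = b ∧ ∀ i < (ω []).1, shift [i] ω ∈ E} =
      (if b then p else 1 - p) * ∑' k, a k * P.real E ^ k := by
  have := hP.1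
  have hset : {ω : Cfg | (ω []).2 = b ∧ ∀ i < (ω []).1, shift [i] ω ∈ E} =
      ⋃ k, {ω : Cfg | ω [] = (k, b) ∧ ∀ i < k, shift [i] ω ∈ E} := by
    ext ω
    simp [Prod.ext_iff]
  have hmeas : ∀ k, MeasurableSet {ω : Cfg | ω [] = (k, b) ∧ ∀ i < k, shift [i] ω ∈ E} := by
    intro k
    refine (measurableSet_edge {(k, b)}).inter ?_
    have h : {ω | ∀ i < k, shift [i] ω ∈ E} = ⋂ i, ⋂ _ : i < k, shift [i] ⁻¹' E := by
      ext ω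
      simp
    change MeasurableSet {ω | ∀ i < k, shift [i] ω ∈ E}
    rw [h]
    exact MeasurableSet.iInter fun i => MeasurableSet.iInter fun _ => measurable_shift [i] hE
  have hb : (0 : ℝ) ≤ if b then p else 1 - p := by
    split_ifs
    exacts [hp.1, sub_nonneg.2 hp.2]
  rw [measureReal_def, hset, measure_iUnion _ hmeas, ENNReal.tsum_toReal_eq]
  · rw [← tsum_mul_left]
    refine tsum_congr fun k => ?_
    rw [hP.measure_branch _ _ hE]
    simp only [ENNReal.toReal_mul, ENNReal.toReal_pow, ENNReal.toReal_ofReal (ha k),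
      ENNReal.toReal_ofReal hb, measureReal_def]
    ring
  · exact fun k => measure_ne_top _ _
  · intro k l hkl
    refine Set.disjoint_left.2 fun ω h1 h2 => hkl ?_
    have := h1.1.symm.trans h2.1
    simpa using this

lemma IsGWPerc.real_branch' (hP : IsGWPerc a p P) (ha : ∀ k, 0 ≤ a k)
    (hp : p ∈ Set.Icc (0 : ℝ) 1) {E : Set Cfg} (hE : MeasurableSet E) :
    P.real {ω | ∀ i < (ω []).1, shift [i] ω ∈ E} = ∑' k, a k * P.real E ^ k := by
  have := hP.1
  have h1 := hP.real_branch ha hp true hE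
  have h2 := hP.real_branch ha hp false hE
  have hm := measurableSet_edgeOpen
  rw [← measureReal_inter_add_sdiff hm]
  have e1 : {ω : Cfg | ∀ i < (ω []).1, shift [i] ω ∈ E} ∩ {ω | EdgeOpen ω} =
      {ω | (ω []).2 = true ∧ ∀ i < (ω []).1, shift [i] ω ∈ E} := by
    ext ω
    simp [EdgeOpen, and_comm]
  have e2 : {ω : Cfg | ∀ i < (ω []).1, shift [i] ω ∈ E} \ {ω | EdgeOpen ω} =
      {ω | (ω []).2 = false ∧ ∀ i < (ω []).1, shift [i] ω ∈ E} := by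
    ext ω
    simp [EdgeOpen, and_comm]
  rw [e1, e2, h1, h2]
  simp
  ring

lemma IsGWPerc.real_edgeOpen (hP : IsGWPerc a p P) (ha : ∀ k, 0 ≤ a k)
    (hp : p ∈ Set.Icc (0 : ℝ) 1) (htotal : ∑' k, a k = 1) : P.real {ω | EdgeOpen ω} = p := by
  have := hP.1
  have h := hP.real_branch ha hp true MeasurableSet.univ
  simpa [htotal, EdgeOpen] using h

lemma IsGWPerc.real_edgeOpen_and_blue (hP : IsGWPerc a p P) (ha : ∀ k, 0 ≤ a k)
    (hp : p ∈ Set.Icc (0 : ℝ) 1) (htotal : ∑' k, a k = 1) :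
    P.real {ω | EdgeOpen ω ∧ Blue ω} = p * P.real {ω | Blue ω} := by
  have := hP.1
  have hE : MeasurableSet {ω | EdgeOpen ω ∧ Blue ω}ᶜ :=
    (measurableSet_edgeOpen.inter measurableSet_blue).compl
  have hnot : ∀ ω : Cfg, ¬ Blue ω ↔
      ∀ i < (ω []).1, shift [i] ω ∈ {ω | EdgeOpen ω ∧ Blue ω}ᶜ := by
    intro ω
    rw [Blue, ray_iff_exists_child]
    simp [Blue]
  have h1 := hP.real_branch ha hp true hE
  have h2 := hP.real_branch' ha hp hE
  simp only [← hnot] at h1 h2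
  have h3 : P.real {ω | ¬ Blue ω} = 1 - P.real {ω | Blue ω} :=
    probReal_compl_eq_one_sub measurableSet_blue
  have h4 := measureReal_inter_add_sdiff (μ := P) (s := {ω | EdgeOpen ω}) measurableSet_blue
  rw [hP.real_edgeOpen ha hp htotal] at h4
  have e1 : {ω | EdgeOpen ω} \ {ω | Blue ω} = {ω | (ω []).2 = true ∧ ¬ Blue ω} := rfl
  have e2 : {ω | EdgeOpen ω} ∩ {ω | Blue ω} = {ω | EdgeOpen ω ∧ Blue ω} := rfl
  rw [e1, e2, h1, ← h2, h3] at h4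
  simp only [if_true] at h4
  linarith

/-- The root is joined to generation `n` by a path without blue vertices. -/
def NonblueLevel (n : ℕ) (ω : Cfg) : Prop := ¬ Blue ω ∧ Level (fun η => ¬ Blue η) n ω

lemma measurableSet_nonblueLevel (n : ℕ) : MeasurableSet {ω | NonblueLevel n ω} :=
  measurableSet_blue.compl.inter (measurableSet_level measurableSet_blue.compl n)

lemma nonblueLevel_succ (n : ℕ) (ω : Cfg) :
    NonblueLevel (n + 1) ω ↔ ¬ Blue ω ∧ ∃ i < (ω []).1, NonblueLevel n (shift [i] ω) :=
  Iff.rfl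

lemma not_blackRoot_iff (ω : Cfg) : ¬ BlackRoot ω ↔ ∀ n, NonblueLevel n ω := by
  simp only [blackRoot_iff, NonblueLevel, not_or, not_not, ray_iff_forall_level, forall_and,
    forall_const]

lemma IsGWPerc.real_nonblueLevel_zero (hP : IsGWPerc a p P) :
    P.real {ω | NonblueLevel 0 ω} = 1 - P.real {ω | Blue ω} := by
  have := hP.1
  rw [← probReal_compl_eq_one_sub measurableSet_blue]
  congr 1
  ext ω
  simp [NonblueLevel, Level]

lemma IsGWPerc.real_nonblueLevel_succ (hP : IsGWPerc a p P) (ha : ∀ k, 0 ≤ a k)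
    (hp : p ∈ Set.Icc (0 : ℝ) 1) (htotal : ∑' k, a k = 1) (n : ℕ) :
    P.real {ω | NonblueLevel (n + 1) ω} =
      1 - P.real {ω | Blue ω} -
        ∑' k, a k * (1 - p * P.real {ω | Blue ω} - P.real {ω | NonblueLevel n ω}) ^ k := by
  have := hP.1
  set C : Set Cfg := {ω | EdgeOpen ω ∧ Blue ω} with hC
  set D : Set Cfg := {ω | NonblueLevel n ω} with hD
  have hCm : MeasurableSet C := measurableSet_edgeOpen.inter measurableSet_blue
  have hDm : MeasurableSet D := measurableSet_nonblueLevel n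
  have hdisj : Disjoint C D := Set.disjoint_left.2 fun ω h1 h2 => h2.1 h1.2
  have hCD : P.real (C ∪ D)ᶜ = 1 - p * P.real {ω | Blue ω} - P.real D := by
    rw [probReal_compl_eq_one_sub (hCm.union hDm), measureReal_union hdisj hDm, hC,
      hP.real_edgeOpen_and_blue ha hp htotal]
    ring
  rw [← hCD, ← hP.real_branch' ha hp (hCm.union hDm).compl,
    ← probReal_compl_eq_one_sub measurableSet_blue]
  have hsub : {ω : Cfg | ∀ i < (ω []).1, shift [i] ω ∈ (C ∪ D)ᶜ} ⊆ {ω | Blue ω}ᶜ := by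
    intro ω h hb
    rw [Set.mem_ofPred_eq, Blue, ray_iff_exists_child] at hb
    obtain ⟨i, hi, hb⟩ := hb
    exact h i hi (Or.inl hb)
  have hm : MeasurableSet {ω : Cfg | ∀ i < (ω []).1, shift [i] ω ∈ (C ∪ D)ᶜ} := by
    simp only [Set.ofPred_forall]
    refine MeasurableSet.iInter fun i => ?_
    have h1 := (measurableSet_edge {x | i < x.1}).compl.union
      (measurable_shift [i] (hCm.union hDm).compl)
    convert h1 using 1
    ext ω
    simp [imp_iff_not_or]
  rw [← measureReal_sdiff hsub hm]
  congr 1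
  ext ω
  simp only [Set.mem_ofPred_eq, nonblueLevel_succ, Set.mem_sdiff, Set.mem_compl_iff]
  refine and_congr_right fun hb => ?_
  have hb' : ∀ i < (ω []).1, shift [i] ω ∉ C := fun i hi h =>
    hb (ray_iff_exists_child.2 ⟨i, hi, h⟩)
  push Not
  refine exists_congr fun i => and_congr_right fun hi => ?_
  simp [hb' i hi, hD]

lemma IsGWPerc.tendsto_real_nonblueLevel (hP : IsGWPerc a p P) :
    Filter.Tendsto (fun n => P.real {ω | NonblueLevel n ω}) Filter.atTop
      (nhds (P.real {ω | ¬ BlackRoot ω})) := by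
  have := hP.1
  have h : {ω | ¬ BlackRoot ω} = ⋂ n, {ω | NonblueLevel n ω} := by
    ext ω
    simp [not_blackRoot_iff]
  rw [h]
  refine (ENNReal.tendsto_toReal (measure_ne_top P _)).comp
    (tendsto_measure_iInter_atTop (fun n => (measurableSet_nonblueLevel n).nullMeasurableSet) ?_
      ⟨0, measure_ne_top P _⟩)
  exact fun m n hmn ω hω => ⟨hω.1, hω.2.of_le hmn⟩

lemma measurableSet_blackRoot : MeasurableSet {ω | BlackRoot ω} := by
  refine MeasurableSet.of_compl ?_
  have h : {ω | BlackRoot ω}ᶜ = ⋂ n, {ω | NonblueLevel n ω} := by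
    ext ω
    simp [not_blackRoot_iff]
  rw [h]
  exact MeasurableSet.iInter measurableSet_nonblueLevel

lemma IsGWPerc.measure_blackRoot_eq_one_iff (hP : IsGWPerc a p P) :
    P {ω | BlackRoot ω} = 1 ↔ P.real {ω | ¬ BlackRoot ω} = 0 := by
  have := hP.1
  rw [← prob_compl_eq_zero_iff measurableSet_blackRoot, measureReal_eq_zero_iff]
  rfl

end Percolation

lemma mul_sub_le_pow_sub_pow {x y : ℝ} (hx : 0 ≤ x) (hxy : x ≤ y) (k : ℕ) :
    k * x ^ (k - 1) * (y - x) ≤ y ^ k - x ^ k := by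
  rw [← geom_sum₂_mul]
  refine mul_le_mul_of_nonneg_right ?_ (sub_nonneg.2 hxy)
  rw [← nsmul_eq_mul, ← Finset.card_range k, ← Finset.sum_const, Finset.card_range]
  refine Finset.sum_le_sum fun i hi => ?_
  rw [show k - 1 = i + (k - 1 - i) by have := Finset.mem_range.1 hi; omega, pow_add,
    Nat.add_sub_cancel_left]
  gcongr

lemma pow_sub_pow_le_mul_sub {x y : ℝ} (hx : 0 ≤ x) (hxy : x ≤ y) (k : ℕ) :
    y ^ k - x ^ k ≤ k * y ^ (k - 1) * (y - x) := by
  rw [← geom_sum₂_mul]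
  refine mul_le_mul_of_nonneg_right ?_ (sub_nonneg.2 hxy)
  rw [← nsmul_eq_mul, ← Finset.card_range k, ← Finset.sum_const, Finset.card_range]
  refine Finset.sum_le_sum fun i hi => ?_
  have hy : 0 ≤ y := hx.trans hxy
  calc y ^ i * x ^ (k - 1 - i) ≤ y ^ i * y ^ (k - 1 - i) := by gcongr
    _ = y ^ (k - 1) := by
      rw [← pow_add]
      congr 1
      have := Finset.mem_range.1 hi
      omega

lemma pow_sub_pow_lt_mul_sub {x y : ℝ} (hx : 0 ≤ x) (hxy : x < y) {k : ℕ} (hk : 2 ≤ k) :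
    y ^ k - x ^ k < k * y ^ (k - 1) * (y - x) := by
  obtain ⟨m, rfl⟩ : ∃ m, k = m + 1 := ⟨k - 1, by omega⟩
  have h := pow_sub_pow_le_mul_sub hx hxy.le m
  have h1 : x ^ m < y ^ m := pow_lt_pow_left₀ hxy hx (by omega)
  have h2 : y * y ^ (m - 1) = y ^ m := by rw [← pow_succ', Nat.sub_add_cancel (by omega)]
  have hy : 0 ≤ y := hx.trans hxy.le
  push_cast
  calc y ^ (m + 1) - x ^ (m + 1) = y * (y ^ m - x ^ m) + (y - x) * x ^ m := by ring
    _ < y * (m * y ^ (m - 1) * (y - x)) + (y - x) * y ^ m :=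
      add_lt_add_of_le_of_lt (mul_le_mul_of_nonneg_left h hy)
        (mul_lt_mul_of_pos_left h1 (sub_pos.2 hxy))
    _ = m * (y * y ^ (m - 1)) * (y - x) + (y - x) * y ^ m := by ring
    _ = (m + 1) * y ^ m * (y - x) := by rw [h2]; ring

/-- `g` is continuous, increasing and strictly convex on `[0,1]` with derivative `g'`, it fixes
`0` and `1`, and its slopes at these points lie on the two sides of `1`. -/
structure IsSupercriticalPGF (g g' : ℝ → ℝ) : Prop where
  continuousOn : ContinuousOn g (Set.Icc 0 1)
  continuousOn_deriv : ContinuousOn g' (Set.Icc 0 1)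
  zero : g 0 = 0
  one : g 1 = 1
  deriv_zero_lt : g' 0 < 1
  lt_deriv_one : 1 < g' 1
  deriv_nonneg : ∀ x, 0 ≤ x → 0 ≤ g' x
  mul_le_sub : ∀ x y, 0 ≤ x → x < y → y ≤ 1 → g' x * (y - x) ≤ g y - g x
  sub_lt_mul : ∀ x y, 0 ≤ x → x < y → y ≤ 1 → g y - g x < g' y * (y - x)

lemma isSupercriticalPGF_tsum {a : ℕ → ℝ} (hpos : ∀ k, 0 ≤ a k) (hsummable : Summable a)
    (htotal : ∑' k, a k = 1) (hzero : a 0 = 0)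
    (hmean_summable : Summable fun k : ℕ => (k : ℝ) * a k)
    (hmean : 1 < ∑' k : ℕ, (k : ℝ) * a k) :
    IsSupercriticalPGF (fun x => ∑' k, a k * x ^ k)
      (fun x => ∑' k : ℕ, (k : ℝ) * a k * x ^ (k - 1)) := by
  obtain ⟨K, hK, haK⟩ : ∃ K, 2 ≤ K ∧ 0 < a K := by
    by_contra! h
    refine hmean.not_ge ?_
    rw [← htotal]
    refine hmean_summable.tsum_le_tsum (fun k => ?_) hsummable
    rcases lt_or_ge k 2 with hk | hk
    · interval_cases k <;> simp [hzero]
    · simp [le_antisymm (h k hk) (hpos k)]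
  have hs : ∀ x ∈ Set.Icc (0 : ℝ) 1, Summable fun k => a k * x ^ k := fun x hx =>
    hsummable.of_nonneg_of_le (fun k => mul_nonneg (hpos k) (pow_nonneg hx.1 k))
      fun k => mul_le_of_le_one_right (hpos k) (pow_le_one₀ hx.1 hx.2)
  have hs' : ∀ x ∈ Set.Icc (0 : ℝ) 1, Summable fun k : ℕ => (k : ℝ) * a k * x ^ (k - 1) :=
    fun x hx => hmean_summable.of_nonneg_of_le
      (fun k => mul_nonneg (mul_nonneg k.cast_nonneg (hpos k)) (pow_nonneg hx.1 _))
      fun k => mul_le_of_le_one_right (mul_nonneg k.cast_nonneg (hpos k))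
        (pow_le_one₀ hx.1 hx.2)
  refine ⟨?_, ?_, ?_, ?_, ?_, ?_, ?_, ?_, ?_⟩
  · refine continuousOn_tsum (fun k => by fun_prop) hsummable fun k x hx => ?_
    rw [Real.norm_of_nonneg (mul_nonneg (hpos k) (pow_nonneg hx.1 k))]
    exact mul_le_of_le_one_right (hpos k) (pow_le_one₀ hx.1 hx.2)
  · refine continuousOn_tsum (fun k => by fun_prop) hmean_summable fun k x hx => ?_
    have hk := mul_nonneg k.cast_nonneg (hpos k)
    rw [Real.norm_of_nonneg (mul_nonneg hk (pow_nonneg hx.1 _))]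
    exact mul_le_of_le_one_right hk (pow_le_one₀ hx.1 hx.2)
  · rw [tsum_eq_single 0 fun k hk => by simp [hk]]
    simp [hzero]
  · simpa using htotal
  · rw [tsum_eq_single 1 fun k hk => by
      rcases Nat.lt_or_gt_of_ne hk with hk | hk
      · simp [Nat.lt_one_iff.1 hk]
      · simp [Nat.sub_ne_zero_of_lt hk]]
    have h := hsummable.sum_le_tsum {1, K} fun k _ => hpos k
    rw [Finset.sum_pair (by omega), htotal] at h
    simp only [Nat.cast_one, one_mul, Nat.sub_self, pow_zero, mul_one]
    linarith
  · simpa using hmean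
  · exact fun x hx => tsum_nonneg fun k =>
      mul_nonneg (mul_nonneg k.cast_nonneg (hpos k)) (pow_nonneg hx _)
  · intro x y hx hxy hy
    have hx' : x ∈ Set.Icc (0 : ℝ) 1 := ⟨hx, by linarith⟩
    have hy' : y ∈ Set.Icc (0 : ℝ) 1 := ⟨by linarith, hy⟩
    rw [← tsum_mul_right, ← (hs y hy').tsum_sub (hs x hx')]
    refine ((hs' x hx').mul_right _).tsum_le_tsum (fun k => ?_) ((hs y hy').sub (hs x hx'))
    have := mul_le_mul_of_nonneg_left (mul_sub_le_pow_sub_pow hx hxy.le k) (hpos k)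
    linarith
  · intro x y hx hxy hy
    have hx' : x ∈ Set.Icc (0 : ℝ) 1 := ⟨hx, by linarith⟩
    have hy' : y ∈ Set.Icc (0 : ℝ) 1 := ⟨by linarith, hy⟩
    rw [← tsum_mul_right, ← (hs y hy').tsum_sub (hs x hx')]
    refine Summable.tsum_lt_tsum (i := K) (fun k => ?_) ?_ ((hs y hy').sub (hs x hx'))
      ((hs' y hy').mul_right _)
    · have := mul_le_mul_of_nonneg_left (pow_sub_pow_le_mul_sub hx hxy.le k) (hpos k)
      linarith
    · have := mul_lt_mul_of_pos_left (pow_sub_pow_lt_mul_sub hx hxy hK) haK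
      linarith

namespace IsSupercriticalPGF

variable {g g' : ℝ → ℝ}

lemma deriv_lt (h : IsSupercriticalPGF g g') {x y : ℝ} (hx : 0 ≤ x) (hxy : x < y)
    (hy : y ≤ 1) : g' x < g' y := by
  have h1 := (h.mul_le_sub x y hx hxy hy).trans_lt (h.sub_lt_mul x y hx hxy hy)
  exact lt_of_mul_lt_mul_right h1 (sub_nonneg.2 hxy.le)

lemma mono (h : IsSupercriticalPGF g g') {x y : ℝ} (hx : 0 ≤ x) (hxy : x ≤ y)
    (hy : y ≤ 1) : g x ≤ g y := by
  rcases hxy.eq_or_lt with rfl | hxy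
  · rfl
  · have h1 := h.mul_le_sub x y hx hxy hy
    have h2 := mul_nonneg (h.deriv_nonneg x hx) (sub_nonneg.2 hxy.le)
    linarith

lemma pos (h : IsSupercriticalPGF g g') {x : ℝ} (hx : 0 < x) (hx1 : x ≤ 1) : 0 < g x := by
  have h0 := h.mono le_rfl (half_pos hx).le (by linarith)
  have h1 := h.mul_le_sub (x / 2) x (by linarith) (by linarith) hx1
  have h2 := (h.deriv_nonneg 0 le_rfl).trans_lt
    (h.deriv_lt le_rfl (half_pos hx) (by linarith))
  have h3 := mul_pos h2 (show 0 < x - x / 2 by linarith)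
  rw [h.zero] at h0
  linarith

/-- Secants through `(1, g 1)` have increasing slopes. -/
lemma secant_lt (h : IsSupercriticalPGF g g') {u v : ℝ} (hu : 0 < u) (huv : u < v)
    (hv : v ≤ 1) : (1 - g (1 - v)) * u < (1 - g (1 - u)) * v := by
  have h1 := h.mul_le_sub (1 - u) 1 (by linarith) (by linarith) le_rfl
  have h2 := h.sub_lt_mul (1 - v) (1 - u) (by linarith) (by linarith) (by linarith)
  rw [h.one] at h1
  have h3 := mul_lt_mul_of_pos_right h2 hu
  have h4 := mul_le_mul_of_nonneg_right h1 (sub_nonneg.2 huv.le)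
  nlinarith

lemma le_of_root (h : IsSupercriticalPGF g g') {u : ℝ} (hu : 0 < u) (hu1 : u ≤ 1) :
    u ≤ 1 - g (1 - u) := by
  rcases hu1.eq_or_lt with rfl | hu1
  · simp [h.zero]
  · have h1 := h.secant_lt hu hu1 le_rfl
    simp only [sub_self, h.zero] at h1
    linarith

/-- The critical percolation density, and the comparison of other densities with it. -/
lemma exists_critical (h : IsSupercriticalPGF g g') {θ : ℝ → ℝ}
    (hθ : ∀ r ∈ Set.Icc (0 : ℝ) 1,
      IsGreatest {t | t ∈ Set.Icc (0 : ℝ) 1 ∧ t = 1 - g (1 - r * t)} (θ r)) :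
    ∃ c : ℝ, (c ∈ Set.Icc (0 : ℝ) 1 ∧ g' (1 - c * θ c) = 1) ∧
      (∀ r ∈ Set.Icc (0 : ℝ) 1, g' (1 - r * θ r) = 1 → r = c) ∧
      ∀ r ∈ Set.Icc (0 : ℝ) 1, g' (1 - r * θ r) ≤ 1 ↔ c ≤ r := by
  obtain ⟨x, hx, hgx⟩ := intermediate_value_Ioo zero_le_one h.continuousOn_deriv
    ⟨h.deriv_zero_lt, h.lt_deriv_one⟩
  obtain ⟨u, rfl⟩ : ∃ u, x = 1 - u := ⟨1 - x, by ring⟩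
  have hu0 : 0 < u := by linarith [hx.2]
  have hu1 : u < 1 := by linarith [hx.1]
  set t := 1 - g (1 - u) with ht
  have hut : u ≤ t := h.le_of_root hu0 hu1.le
  have ht0 : 0 < t := hu0.trans_le hut
  have ht1 : t ≤ 1 := by
    have := h.mono le_rfl hx.1.le hx.2.le
    rw [h.zero] at this
    linarith
  have hc : u / t ∈ Set.Icc (0 : ℝ) 1 := ⟨by positivity, div_le_one_of_le₀ hut ht0.le⟩
  have hct : u / t * t = u := div_mul_cancel₀ _ ht0.ne'
  have hprod : ∀ r ∈ Set.Icc (0 : ℝ) 1, r * θ r ∈ Set.Icc (0 : ℝ) 1 := fun r hr =>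
    ⟨mul_nonneg hr.1 (hθ r hr).1.1.1, mul_le_one₀ hr.2 (hθ r hr).1.1.1 (hθ r hr).1.1.2⟩
  have hge : ∀ r ∈ Set.Icc (0 : ℝ) 1, u ≤ r * θ r → u / t ≤ r := by
    intro r hr hur
    have hroot := (hθ r hr).1.2
    rw [div_le_iff₀ ht0]
    rcases hur.eq_or_lt with he | hlt
    · rw [← he, ← ht] at hroot
      rw [← hroot, ← he]
    · have h1 := h.secant_lt hu0 hlt (hprod r hr).2
      rw [← hroot, ← ht] at h1
      have hθ0 : 0 < θ r := by
        by_contra! h0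
        have := mul_nonpos_of_nonneg_of_nonpos hr.1 h0
        linarith
      refine le_of_mul_le_mul_left (a := θ r) ?_ hθ0
      linarith
  have hle : ∀ r ∈ Set.Icc (0 : ℝ) 1, u / t ≤ r → u ≤ r * θ r := by
    intro r hr hcr
    have hur : u ≤ r * t := (div_le_iff₀ ht0).1 hcr
    suffices t ≤ θ r from hur.trans (mul_le_mul_of_nonneg_left this hr.1)
    have hmem : ∀ s ∈ Set.Icc t 1, 1 - r * s ∈ Set.Icc (0 : ℝ) 1 := fun s hs => by
      have h0 : 0 ≤ s := ht0.le.trans hs.1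
      exact ⟨sub_nonneg.2 (mul_le_one₀ hr.2 h0 hs.2), by linarith [mul_nonneg hr.1 h0]⟩
    have hcont : ContinuousOn (fun s => 1 - g (1 - r * s) - s) (Set.Icc t 1) := by
      refine (continuousOn_const.sub (h.continuousOn.comp (by fun_prop) hmem)).sub
        continuousOn_id
    have h0 : (0 : ℝ) ∈ Set.Icc (1 - g (1 - r * 1) - 1) (1 - g (1 - r * t) - t) := by
      have m1 := hmem 1 ⟨ht1, le_rfl⟩
      have m2 := hmem t ⟨le_rfl, ht1⟩
      have h1 := h.mono le_rfl m1.1 m1.2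
      have h2 := h.mono m2.1 (sub_le_sub_left hur 1) hx.2.le
      rw [h.zero] at h1
      constructor <;> linarith
    obtain ⟨s, hs, hs0⟩ := intermediate_value_Icc' ht1 hcont h0
    exact hs.1.trans ((hθ r hr).2 ⟨⟨ht0.le.trans hs.1, hs.2⟩, by simp only at hs0; linarith⟩)
  have hderiv : ∀ r ∈ Set.Icc (0 : ℝ) 1, g' (1 - r * θ r) ≤ 1 ↔ u ≤ r * θ r := by
    intro r hr
    have hp := hprod r hr
    constructor
    · intro h1
      by_contra! h2
      have := h.deriv_lt hx.1.le (sub_lt_sub_left h2 1) (by linarith [hp.1])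
      linarith
    · intro h1
      rcases h1.eq_or_lt with h1 | h1
      · rw [← h1, hgx]
      · have := h.deriv_lt (by linarith [hp.2]) (sub_lt_sub_left h1 1) hx.2.le
        linarith
  have heq : ∀ r ∈ Set.Icc (0 : ℝ) 1, g' (1 - r * θ r) = 1 → r * θ r = u := by
    intro r hr h1
    refine ((hderiv r hr).1 h1.le).antisymm' ?_
    by_contra! h2
    have := h.deriv_lt (by linarith [(hprod r hr).2]) (sub_lt_sub_left h2 1) hx.2.le
    linarith
  have huniq : ∀ r ∈ Set.Icc (0 : ℝ) 1, r * θ r = u → r = u / t := by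
    intro r hr h1
    have hroot := (hθ r hr).1.2
    rw [h1, ← ht] at hroot
    rw [eq_div_iff ht0.ne', ← hroot, h1]
  have hθc : θ (u / t) = t := by
    refine le_antisymm ?_ ((hθ _ hc).2 ⟨⟨ht0.le, ht1⟩, by rw [hct]⟩)
    by_contra! hlt
    have hlt' : u < u / t * θ (u / t) := by
      calc u = u / t * t := hct.symm
        _ < _ := mul_lt_mul_of_pos_left hlt (by positivity)
    have h1 := h.secant_lt hu0 hlt' (hprod _ hc).2
    rw [← (hθ _ hc).1.2, ← ht] at h1
    have h2 : t * (u / t * θ (u / t)) = θ (u / t) * u := by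
      field_simp
    linarith
  refine ⟨u / t, ⟨hc, by rw [hθc, hct, hgx]⟩, fun r hr h1 => huniq r hr (heq r hr h1),
    fun r hr => (hderiv r hr).trans ⟨hge r hr, hle r hr⟩⟩

/-- The limit of the iterates of `q ↦ g x - g (x - q)` started from `g x` vanishes exactly when
the slope of this map at `0`, which is `g' x`, is at most `1`. -/
lemma limit_eq_zero_iff (h : IsSupercriticalPGF g g') {x : ℝ} (hx0 : 0 < x) (hx1 : x ≤ 1)
    (hgx : 0 < g x) (hgx_le : g x ≤ x) {q : ℕ → ℝ} {l : ℝ} (hq0 : q 0 = g x)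
    (hq : ∀ n, q (n + 1) = g x - g (x - q n)) (hq_nonneg : ∀ n, 0 ≤ q n)
    (hq_le : ∀ n, q n ≤ g x) (hl : Filter.Tendsto q Filter.atTop (nhds l)) :
    l = 0 ↔ g' x ≤ 1 := by
  constructor
  · intro hl0
    by_contra! h1
    obtain ⟨y, hy0, hyx, hy1, hyg⟩ : ∃ y, 0 ≤ y ∧ y < x ∧ 1 ≤ g' y ∧ x - y ≤ g x := by
      have hcont : Filter.Tendsto g' (nhdsWithin x (Set.Ioo 0 x)) (nhds (g' x)) :=
        (h.continuousOn_deriv x ⟨hx0.le, hx1⟩).mono_left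
          (nhdsWithin_mono x fun z hz => ⟨hz.1.le, hz.2.le.trans hx1⟩)
      have hsub : ∀ᶠ y in nhdsWithin x (Set.Ioo 0 x), x - g x < y :=
        (eventually_gt_nhds (by linarith)).filter_mono nhdsWithin_le_nhds
      have hne : (nhdsWithin x (Set.Ioo 0 x)).NeBot := right_nhdsWithin_Ioo_neBot hx0
      obtain ⟨y, ⟨hy1, hy2⟩, hy3⟩ :=
        ((hcont.eventually (lt_mem_nhds h1)).and hsub |>.and self_mem_nhdsWithin).exists
      exact ⟨y, hy3.1.le, hy3.2, hy1.le, by linarith⟩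
    have hlow : ∀ n, x - y ≤ q n := by
      intro n
      induction n with
      | zero => rwa [hq0]
      | succ n ih =>
        rw [hq]
        have h2 := h.mono (by linarith [hq_le n]) (show x - q n ≤ y by linarith)
          (hyx.le.trans hx1)
        have h3 := h.mul_le_sub y x hy0 hyx hx1
        have h4 := mul_le_mul_of_nonneg_right hy1 (sub_nonneg.2 hyx.le)
        linarith
    have := ge_of_tendsto' hl hlow
    linarith
  · intro h1
    have hl0 : 0 ≤ l := ge_of_tendsto' hl hq_nonneg
    have hlx : l ≤ g x := le_of_tendsto' hl hq_le
    have hmem : ∀ z, 0 ≤ z → z ≤ g x → x - z ∈ Set.Icc (0 : ℝ) 1 := fun z hz hzx =>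
      ⟨by linarith, by linarith⟩
    have hfix : l = g x - g (x - l) := by
      refine tendsto_nhds_unique (hl.comp (Filter.tendsto_add_atTop_nat 1)) ?_
      simp only [Function.comp_def, hq]
      refine tendsto_const_nhds.sub ?_
      refine (h.continuousOn (x - l) (hmem l hl0 hlx)).tendsto.comp ?_
      exact tendsto_nhdsWithin_iff.2 ⟨tendsto_const_nhds.sub hl,
        Filter.Eventually.of_forall fun n => hmem _ (hq_nonneg n) (hq_le n)⟩
    by_contra hne
    have hlpos : 0 < l := lt_of_le_of_ne hl0 (Ne.symm hne)
    have h2 := h.sub_lt_mul (x - l) x (by linarith) (by linarith) hx1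
    have h3 := mul_le_mul_of_nonneg_right h1 hl0
    rw [sub_sub_cancel] at h2
    linarith

end IsSupercriticalPGF

/-- Consider a branching process whose family-size probability generating
function `G` satisfies `G(0) = 0` and `1 < G'(1) < ∞`, with bond percolation of density
`p ∈ [0,1)` on its family-tree; `θ(r)` denotes the largest root in `[0,1]` of
`θ = 1 - G(1 - rθ)`, which at `r = p` is the probability that the root is blue. The
following are equivalent: (i) `γ = 1`, i.e. almost surely every infinite directed path
from the root contains a blue vertex; (ii) `G'(1 - pθ(p)) ≤ 1`; (iii) `p_G ≤ p ≤ 1`,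
where `p_G` is the unique value in `[0,1]` satisfying `G'(1 - p_G θ(p_G)) = 1`
(in particular such a value exists and is unique). -/
theorem gamma_eq_one_iff (a : ℕ → ℝ) (hpos : ∀ k, 0 ≤ a k) (hsummable : Summable a)
    (htotal : ∑' k, a k = 1) (hzero : a 0 = 0)
    (hmean_summable : Summable fun k : ℕ => (k : ℝ) * a k)
    (hmean : 1 < ∑' k : ℕ, (k : ℝ) * a k)
    (G : ℝ → ℝ) (hG : ∀ x, G x = ∑' k, a k * x ^ k)
    (G' : ℝ → ℝ) (hG' : ∀ x, G' x = ∑' k : ℕ, (k : ℝ) * a k * x ^ (k - 1))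
    (p : ℝ) (hp : p ∈ Set.Ico (0 : ℝ) 1)
    (P : Measure Cfg) (hP : IsGWPerc a p P)
    (θ : ℝ → ℝ)
    (hθ : ∀ r ∈ Set.Icc (0 : ℝ) 1,
      IsGreatest {t | t ∈ Set.Icc (0 : ℝ) 1 ∧ t = 1 - G (1 - r * t)} (θ r))
    (hθp : (P {ω | BlueAt ω []}).toReal = θ p) :
    ∃ pG : ℝ, (pG ∈ Set.Icc (0 : ℝ) 1 ∧ G' (1 - pG * θ pG) = 1) ∧
      (∀ r ∈ Set.Icc (0 : ℝ) 1, G' (1 - r * θ r) = 1 → r = pG) ∧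
      (P {ω | BlackRoot ω} = 1 ↔ G' (1 - p * θ p) ≤ 1) ∧
      (P {ω | BlackRoot ω} = 1 ↔ pG ≤ p ∧ p ≤ 1) := by
  obtain rfl : G = fun x => ∑' k, a k * x ^ k := funext hG
  obtain rfl : G' = fun x => ∑' k : ℕ, (k : ℝ) * a k * x ^ (k - 1) := funext hG'
  have h := isSupercriticalPGF_tsum hpos hsummable htotal hzero hmean_summable hmean
  have hp' : p ∈ Set.Icc (0 : ℝ) 1 := ⟨hp.1, hp.2.le⟩
  obtain ⟨c, hc, hc_unique, hc_iff⟩ := h.exists_critical hθ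
  suffices hblack : P {ω | BlackRoot ω} = 1 ↔
      ∑' k : ℕ, (k : ℝ) * a k * (1 - p * θ p) ^ (k - 1) ≤ 1 from
    ⟨c, hc, hc_unique, hblack, hblack.trans ((hc_iff p hp').trans (by simp [hp.2.le]))⟩
  have hprob := hP.1
  obtain ⟨⟨hθ0, hθ1⟩, hroot⟩ := (hθ p hp').1
  have hblue : P.real {ω | Blue ω} = θ p := by
    simpa only [blueAt_nil_iff, measureReal_def] using hθp
  have hpθ : p * θ p ≤ p := mul_le_of_le_one_right hp.1 hθ1
  have hpθ' : p * θ p ≤ θ p := mul_le_of_le_one_left hθ0 hp.2.le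
  have hx0 : 0 < 1 - p * θ p := by linarith [hp.2]
  have hx1 : 1 - p * θ p ≤ 1 := by linarith [mul_nonneg hp.1 hθ0]
  have hgx : ∑' k, a k * (1 - p * θ p) ^ k = 1 - θ p := by linarith
  have hpos_gx := h.pos hx0 hx1
  have hzero_eq := hP.real_nonblueLevel_zero
  rw [hblue, ← hgx] at hzero_eq
  rw [hP.measure_blackRoot_eq_one_iff]
  refine h.limit_eq_zero_iff hx0 hx1 hpos_gx (by linarith) hzero_eq (fun n => ?_)
    (fun _ => measureReal_nonneg) (fun n => ?_) hP.tendsto_real_nonblueLevel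
  · rw [hP.real_nonblueLevel_succ hpos hp' htotal, hblue, hgx]
  · rw [← hzero_eq]
    exact measureReal_mono fun ω hω => ⟨hω.1, trivial⟩

end GW
end

section
/- Let G satisfy G(0)=0 and 1<G'(1)<∞, and let p_G be the unique value of p∈[0,1] satisfying G'(1−p_G·θ(p_G))=1. Then p_G is characterised as the value of p∈[0,1] which maximises the function p ↦ (1−p)θ(p). -/
/-- A monomial of degree at least two lies strictly above its tangents on `[0, ∞)`. -/
theorem pow_tangent_lt {y z : ℝ} (hy : 0 ≤ y) (hz : 0 ≤ z) (hyz : y ≠ z) (n : ℕ) :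
    z ^ (n + 2) + ((n + 2 : ℕ) : ℝ) * z ^ (n + 1) * (y - z) < y ^ (n + 2) := by
  have hsq : 0 < (y - z) ^ 2 := by have := sub_ne_zero.2 hyz; positivity
  induction n with
  | zero => norm_num; nlinarith
  | succ n ih =>
    have key : y ^ (n + 3) - z ^ (n + 3) - ((n + 3 : ℕ) : ℝ) * z ^ (n + 2) * (y - z) =
        y * (y ^ (n + 2) - (z ^ (n + 2) + ((n + 2 : ℕ) : ℝ) * z ^ (n + 1) * (y - z))) +
          ((n + 2 : ℕ) : ℝ) * z ^ (n + 1) * (y - z) ^ 2 := by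
      push_cast
      ring
    have hdiff := sub_pos.2 ih
    rcases hy.eq_or_lt with rfl | hy'
    · have hz' : 0 < z := lt_of_le_of_ne hz hyz
      have : 0 < ((n + 2 : ℕ) : ℝ) * z ^ (n + 1) * (0 - z) ^ 2 := by positivity
      show z ^ (n + 3) + ((n + 3 : ℕ) : ℝ) * z ^ (n + 2) * (0 - z) < 0 ^ (n + 3)
      linarith
    · have h₁ := mul_pos hy' hdiff
      have h₂ : 0 ≤ ((n + 2 : ℕ) : ℝ) * z ^ (n + 1) * (y - z) ^ 2 := by positivity
      show z ^ (n + 3) + ((n + 3 : ℕ) : ℝ) * z ^ (n + 2) * (y - z) < y ^ (n + 3)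
      linarith

theorem pow_tangent_le {y z : ℝ} (hy : 0 ≤ y) (hz : 0 ≤ z) (k : ℕ) :
    z ^ k + (k : ℝ) * z ^ (k - 1) * (y - z) ≤ y ^ k := by
  rcases eq_or_ne y z with rfl | hyz
  · simp
  · match k with
    | 0 => simp
    | 1 => simp
    | n + 2 => exact (pow_tangent_lt hy hz hyz n).le

/-- A probability distribution on the positive integers with mean greater than one charges
some integer that is at least two. -/
theorem exists_pos_of_one_lt_mean {a : ℕ → ℝ} (hpos : ∀ k, 0 ≤ a k) (hsummable : Summable a)
    (htotal : ∑' k, a k = 1) (hmean : 1 < ∑' k : ℕ, (k : ℝ) * a k) :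
    ∃ n, 0 < a (n + 2) := by
  by_contra! h
  have hz : ∀ n, a (n + 2) = 0 := fun n => le_antisymm (h n) (hpos _)
  have hmean_eq : ∑' k : ℕ, (k : ℝ) * a k = a 1 := by
    rw [tsum_eq_single 1]
    · simp
    · intro k hk
      match k with
      | 0 => simp
      | 1 => exact absurd rfl hk
      | n + 2 => simp [hz n]
  have := hsummable.le_tsum 1 fun k _ => hpos k
  linarith

/-- A power series with nonnegative coefficients lies above its tangents on `[0, 1]`, and strictly
so if it has a positive coefficient of degree at least two. -/
theorem tsum_tangent {a : ℕ → ℝ} (hpos : ∀ k, 0 ≤ a k) (hsummable : Summable a)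
    (hmean_summable : Summable fun k : ℕ => (k : ℝ) * a k) {y z : ℝ}
    (hy : y ∈ Set.Icc (0 : ℝ) 1) (hz : z ∈ Set.Icc (0 : ℝ) 1) :
    ∑' k, a k * z ^ k + (∑' k : ℕ, (k : ℝ) * a k * z ^ (k - 1)) * (y - z) ≤ ∑' k, a k * y ^ k ∧
      (y ≠ z → (∃ n, 0 < a (n + 2)) →
        ∑' k, a k * z ^ k + (∑' k : ℕ, (k : ℝ) * a k * z ^ (k - 1)) * (y - z) <
          ∑' k, a k * y ^ k) := by
  have hs : ∀ x ∈ Set.Icc (0 : ℝ) 1, Summable fun k => a k * x ^ k := fun x hx =>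
    Summable.of_nonneg_of_le (fun k => mul_nonneg (hpos k) (pow_nonneg hx.1 k))
      (fun k => mul_le_of_le_one_right (hpos k) (pow_le_one₀ hx.1 hx.2)) hsummable
  have hs' : Summable fun k : ℕ => (k : ℝ) * a k * z ^ (k - 1) :=
    Summable.of_nonneg_of_le
      (fun k => mul_nonneg (mul_nonneg k.cast_nonneg (hpos k)) (pow_nonneg hz.1 _))
      (fun k => mul_le_of_le_one_right (mul_nonneg k.cast_nonneg (hpos k))
        (pow_le_one₀ hz.1 hz.2)) hmean_summable
  have hsum := (hs z hz).add (hs'.mul_right (y - z))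
  have hterm (k : ℕ) : a k * z ^ k + (k : ℝ) * a k * z ^ (k - 1) * (y - z) =
      a k * (z ^ k + (k : ℝ) * z ^ (k - 1) * (y - z)) := by ring
  have hle (k : ℕ) : a k * z ^ k + (k : ℝ) * a k * z ^ (k - 1) * (y - z) ≤ a k * y ^ k := by
    rw [hterm]
    exact mul_le_mul_of_nonneg_left (pow_tangent_le hy.1 hz.1 k) (hpos k)
  rw [← tsum_mul_right, ← (hs z hz).tsum_add (hs'.mul_right (y - z))]
  refine ⟨hsum.tsum_le_tsum hle (hs y hy), fun hyz ⟨n, hn⟩ => ?_⟩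
  refine Summable.tsum_lt_tsum (i := n + 2) hle ?_ hsum (hs y hy)
  rw [hterm]
  exact mul_lt_mul_of_pos_left (pow_tangent_lt hy.1 hz.1 hyz n) hn


/-- Let `(a k)_{k≥1}` be a probability distribution on the positive
integers whose probability generating function `G` satisfies `G(0) = 0` and
`1 < G'(1) < ∞`. For `r ∈ [0,1]` let `θ(r)` be the largest root in `[0,1]` of
`θ = 1 - G(1 - rθ)`, and let `p_G` be the unique value of `p ∈ [0,1]` satisfying
`G'(1 - p_G θ(p_G)) = 1`. Then `p_G` is characterised as the value of `p ∈ [0,1]` which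
maximises the function `p ↦ (1 - p) θ(p)`. -/
theorem pG_maximises (a : ℕ → ℝ) (hpos : ∀ k, 0 ≤ a k) (hsummable : Summable a)
    (htotal : ∑' k, a k = 1) (hzero : a 0 = 0)
    (hmean_summable : Summable fun k : ℕ => (k : ℝ) * a k)
    (hmean : 1 < ∑' k : ℕ, (k : ℝ) * a k)
    (G : ℝ → ℝ) (hG : ∀ x, G x = ∑' k, a k * x ^ k)
    (G' : ℝ → ℝ) (hG' : ∀ x, G' x = ∑' k : ℕ, (k : ℝ) * a k * x ^ (k - 1))
    (θ : ℝ → ℝ)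
    (hθ : ∀ r ∈ Set.Icc (0 : ℝ) 1,
      IsGreatest {t | t ∈ Set.Icc (0 : ℝ) 1 ∧ t = 1 - G (1 - r * t)} (θ r))
    (pG : ℝ) (hpG : pG ∈ Set.Icc (0 : ℝ) 1) (hpGeq : G' (1 - pG * θ pG) = 1)
    (hpGuniq : ∀ r ∈ Set.Icc (0 : ℝ) 1, G' (1 - r * θ r) = 1 → r = pG) :
    IsMaxOn (fun r => (1 - r) * θ r) (Set.Icc (0 : ℝ) 1) pG ∧
      ∀ r ∈ Set.Icc (0 : ℝ) 1, IsMaxOn (fun r => (1 - r) * θ r) (Set.Icc (0 : ℝ) 1) r →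
        r = pG := by
  have hmem : ∀ r ∈ Set.Icc (0 : ℝ) 1, 1 - r * θ r ∈ Set.Icc (0 : ℝ) 1 := by
    intro r hr
    have ht := (hθ r hr).1.1
    exact ⟨sub_nonneg.2 (mul_le_one₀ hr.2 ht.1 ht.2), sub_le_self _ (mul_nonneg hr.1 ht.1)⟩
  have hval : ∀ r ∈ Set.Icc (0 : ℝ) 1,
      (1 - r) * θ r = (1 - r * θ r) - G (1 - r * θ r) := by
    intro r hr
    have := (hθ r hr).1.2
    linarith
  have htangent := fun r hr =>
    tsum_tangent hpos hsummable hmean_summable (hmem r hr) (hmem pG hpG)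
  simp only [← hG, ← hG', hpGeq, one_mul] at htangent
  have hmax : IsMaxOn (fun r => (1 - r) * θ r) (Set.Icc (0 : ℝ) 1) pG := by
    intro r hr
    have := (htangent r hr).1
    show (1 - r) * θ r ≤ (1 - pG) * θ pG
    rw [hval r hr, hval pG hpG]
    linarith
  refine ⟨hmax, fun r hr hrmax => hpGuniq r hr ?_⟩
  by_contra hne
  have hyz : 1 - r * θ r ≠ 1 - pG * θ pG := fun h => hne (h ▸ hpGeq)
  have hlt := (htangent r hr).2 hyz
    (exists_pos_of_one_lt_mean hpos hsummable htotal hmean)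
  have hge : (1 - pG) * θ pG ≤ (1 - r) * θ r := hrmax hpG
  rw [hval r hr, hval pG hpG] at hge
  linarith
end
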